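/- Let G be a hypergraph on vertex set [n], let k(G) = min_{e ∈ E(G)} |e|, and let 2 ≤ d ≤ n. If (d-1)·k(G) > n - 1, then β^d(G) ≤ ⌈(n-1)/(d-1)⌉·(d+1). -/

import Mathlib

open Finset

/-- A bicoloring `X` (a `±1` function on a subset of `[n]`, encoded as a `{-1,0,1}`-valued
function that is zero outside its domain) *induced-bisects* a set `A` if
`|A ∩ X⁻¹(+1)| = |A ∩ X⁻¹(-1)| ≠ 0`. -/
def Bisects {n : ℕ} (X : Fin n → ℤ) (A : Finset (Fin n)) : Prop :=
  (A.filter fun i => X i = 1).card = (A.filter fun i => X i = -1).card ∧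
    (A.filter fun i => X i = 1).card ≠ 0

/-- `X` encodes a bicoloring of a `d`-element subset of `[n]`: it takes values in
`{-1,0,1}` and has exactly `d` nonzero values. -/
def IsBicoloring {n : ℕ} (d : ℕ) (X : Fin n → ℤ) : Prop :=
  (∀ i, X i = -1 ∨ X i = 0 ∨ X i = 1) ∧
    (Finset.univ.filter fun i => X i ≠ 0).card = d

/-- `𝒳` is an induced-bisecting family of order `d` for the hypergraph on `[n]` with
hyperedge set `E`: every member is a bicoloring of a `d`-element set, and every
non-trivial hyperedge (one that is neither empty nor a singleton, nor — when `d` is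
odd — the whole vertex set) is induced-bisected by some member. -/
def IsIBF {n : ℕ} (d : ℕ) (E : Finset (Finset (Fin n))) (𝒳 : Finset (Fin n → ℤ)) : Prop :=
  (∀ X ∈ 𝒳, IsBicoloring d X) ∧
    ∀ A ∈ E, 2 ≤ A.card → (Odd d → A ≠ Finset.univ) → ∃ X ∈ 𝒳, Bisects X A

/-- `β^d(G)`: the minimum cardinality of an induced-bisecting family of order `d` for the
hypergraph on `[n]` with hyperedge set `E`. -/
noncomputable def betaG {n : ℕ} (d : ℕ) (E : Finset (Finset (Fin n))) : ℕ :=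
  sInf {t | ∃ 𝒳 : Finset (Fin n → ℤ), 𝒳.card = t ∧ IsIBF d E 𝒳}

/-- A walk of odd period built from the reflections `w ↦ -w` and `w ↦ 2 - w` meets the fixed
point of one of the reflections at a time when that reflection is applied. -/
lemma exists_eq_of_odd_period {k : ℕ} (hk : Odd k) {β w : ℕ → ℤ}
    (hβ : ∀ t, β t = 0 ∨ β t = 1) (hw : ∀ t, w (t + 1) = 2 * β t - w t)
    (hper : ∀ t, w (t + k) = w t) : ∃ t, w t = β t := by
  by_contra! hne
  have key : ∀ t, ((if 0 < w t then w t - 1 else -w t) - (if 0 < w 0 then w 0 - 1 else -w 0)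
      - t) % 2 = 0 := by
    intro t
    induction t with
    | zero => simp
    | succ t ih =>
      have h1 := hw t
      have h2 := hne t
      push_cast
      rcases hβ t with h | h <;> rw [h] at h1 h2 <;> split_ifs at ih ⊢ <;> omega
  have h := key k
  have h0 := hper 0
  rw [zero_add] at h0
  rw [h0] at h
  obtain ⟨j, rfl⟩ := hk
  push_cast at h
  omega

lemma exists_eq_add_of_even {k : ℕ} (hk : Odd k) {β w : ℕ → ℤ}
    (hβ : ∀ t, β t = 0 ∨ β t = 1) (hw : ∀ t, w (t + 1) = 2 * β t - w t)
    (hper : ∀ t, w (t + k) = w t) (hβper : ∀ t, β (t + k) = β t) (heven : Even (w 0))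
    (h1 : ∃ t, β t = 1) : (∃ t, w t = β t + 1) ∧ ∃ t, w t = β t - 1 := by
  have hev : ∀ t, Even (w t) := by
    intro t
    induction t with
    | zero => exact heven
    | succ t ih => rw [hw t]; exact (even_two_mul _).sub ih
  have hperj : ∀ j t, w (t + j * k) = w t := by
    intro j t
    induction j with
    | zero => simp
    | succ j ih => rw [add_mul, one_mul, ← add_assoc, hper, ih]
  have hβperj : ∀ j t, β (t + j * k) = β t := by
    intro j t
    induction j with
    | zero => simp
    | succ j ih => rw [add_mul, one_mul, ← add_assoc, hβper, ih]
  have hkpos : 0 < k := hk.pos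
  obtain ⟨t₀, ht₀⟩ : ∃ t, w t = 0 := by
    obtain ⟨t, ht⟩ := exists_eq_of_odd_period hk hβ hw hper
    refine ⟨t, ?_⟩
    obtain ⟨c, hc⟩ := hev t
    rcases hβ t with h | h <;> omega
  obtain ⟨t₁, ht₁⟩ := h1
  constructor
  · by_contra! hne
    have hw1 : w (t₁ + 1) ≠ 0 := by
      have := hw t₁
      have := hne t₁
      omega
    have stay : ∀ s, w (t₁ + 1 + s) ≠ 0 := by
      intro s
      induction s with
      | zero => exact hw1
      | succ s ih =>
        have h2 := hw (t₁ + 1 + s)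
        have h3 := hne (t₁ + 1 + s)
        rw [← add_assoc]
        rcases hβ (t₁ + 1 + s) with h | h <;> omega
    have h4 : t₁ + 1 ≤ t₀ + (t₁ + 1) * k := by nlinarith
    obtain ⟨s, hs⟩ := Nat.exists_eq_add_of_le h4
    exact stay s (by rw [← hs, hperj, ht₀])
  · by_contra! hne
    have stay : ∀ s, w (t₀ + s) = 0 := by
      intro s
      induction s with
      | zero => exact ht₀
      | succ s ih =>
        have h2 := hw (t₀ + s)
        have h3 := hne (t₀ + s)
        rw [← add_assoc]
        rcases hβ (t₀ + s) with h | h <;> omega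
    have h4 : t₀ ≤ t₁ + t₀ * k := by nlinarith
    obtain ⟨s, hs⟩ := Nat.exists_eq_add_of_le h4
    have h5 := stay s
    rw [← hs] at h5
    have h6 := hβperj t₀ t₁
    exact hne (t₁ + t₀ * k) (by omega)

lemma exists_eq_add_of_odd_period {k : ℕ} (hk : Odd k) {β w : ℕ → ℤ}
    (hβ : ∀ t, β t = 0 ∨ β t = 1) (hw : ∀ t, w (t + 1) = 2 * β t - w t)
    (hper : ∀ t, w (t + k) = w t) (hβper : ∀ t, β (t + k) = β t)
    (h0 : ∃ t, β t = 0) (h1 : ∃ t, β t = 1) :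
    (∃ t, w t = β t + 1) ∧ ∃ t, w t = β t - 1 := by
  rcases Int.even_or_odd (w 0) with he | ho
  · exact exists_eq_add_of_even hk hβ hw hper hβper he h1
  · have := exists_eq_add_of_even (β := fun t => 1 - β t) (w := fun t => 1 - w t) hk
      (fun t => by rcases hβ t with h | h <;> simp [h]) (fun t => by simp only [hw t]; ring)
      (fun t => by simp only [hper t]) (fun t => by simp only [hβper t])
      (by obtain ⟨c, hc⟩ := ho; exact ⟨-c, by simp only [hc]; ring⟩)
      (by obtain ⟨t, ht⟩ := h0; exact ⟨t, by simp [ht]⟩)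
    obtain ⟨⟨s, hs⟩, t, ht⟩ := this
    exact ⟨⟨t, by omega⟩, s, by omega⟩

/-- The sign of the `j`-th point in the `t`-th of the sliding alternating colorings. -/
def slidingSign (t j : ℕ) : ℤ :=
  if j = t then 0 else if t < j then (-1) ^ j else -(-1) ^ j

lemma sum_mul_slidingSign (β : ℕ → ℤ) {t k : ℕ} (ht : t < k) :
    ∑ j ∈ range k, β j * slidingSign t j =
      ∑ j ∈ range k, (-1) ^ j * β j - ∑ j ∈ range t, (-1) ^ j * β j
        - ∑ j ∈ range (t + 1), (-1) ^ j * β j := by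
  induction k, Nat.succ_le_of_lt ht using Nat.le_induction with
  | base =>
    have : ∑ j ∈ range t, β j * slidingSign t j = -∑ j ∈ range t, (-1) ^ j * β j := by
      rw [← sum_neg_distrib]
      refine sum_congr rfl fun j hj => ?_
      rw [mem_range] at hj
      simp only [slidingSign, hj.ne, hj.not_gt, if_false]
      ring
    rw [Nat.succ_eq_add_one, sum_range_succ, this]
    simp [slidingSign]
  | succ k hk ih =>
    rw [sum_range_succ, ih hk, sum_range_succ _ k]
    have h1 : k ≠ t := by omega
    have h2 : t < k := hk
    simp only [slidingSign, h1, h2, if_false, if_true]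
    ring

/-- Discrete intermediate value properties of the sliding alternating colorings of an odd number
of points, read on an arbitrary `0`-`1` sequence. -/
lemma sliding_values {k : ℕ} (hk : Odd k) (β : ℕ → ℤ) (hβ : ∀ t, β t = 0 ∨ β t = 1) :
    (∃ t < k, ∑ j ∈ range k, β j * slidingSign t j = 0) ∧
      ((∃ t < k, β t = 0) → (∃ t < k, β t = 1) → ∀ c : ℤ, (c = 1 ∨ c = -1) →
        ∃ t < k, ∑ j ∈ range k, β j * slidingSign t j + c * (-1) ^ t = 0) := by
  have hkpos : 0 < k := hk.pos
  set b : ℕ → ℤ := fun t => β (t % k) with hb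
  have hbβ : ∀ t < k, b t = β t := fun t ht => by simp [hb, Nat.mod_eq_of_lt ht]
  set L : ℕ → ℤ := fun t => ∑ j ∈ range t, (-1) ^ j * b j with hL
  set w : ℕ → ℤ := fun t => (-1) ^ t * (L k - 2 * L t) with hw
  have hb01 : ∀ t, b t = 0 ∨ b t = 1 := fun t => hβ _
  have hsq : ∀ t : ℕ, ((-1 : ℤ) ^ t) * (-1) ^ t = 1 := fun t => by
    rw [← mul_pow]; simp
  have hLs : ∀ t, L (t + 1) = L t + (-1) ^ t * b t := fun t => by
    simp only [hL, sum_range_succ]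
  have hwrec : ∀ t, w (t + 1) = 2 * b t - w t := by
    intro t
    simp only [hw, hLs, pow_succ]
    linear_combination (2 * b t) * hsq t
  have hbper : ∀ t, b (t + k) = b t := fun t => by simp [hb]
  have hwper : ∀ t, w (t + k) = w t := by
    intro t
    induction t with
    | zero =>
      simp only [hw, zero_add, hk.neg_one_pow, hL]
      simp
      ring
    | succ t ih =>
      rw [show t + 1 + k = t + k + 1 by ring, hwrec, hwrec, ih, hbper]
  have hsum : ∀ t < k, ∑ j ∈ range k, β j * slidingSign t j = (-1) ^ t * (w t - b t) := by
    intro t ht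
    have hcongr : ∑ j ∈ range k, β j * slidingSign t j = ∑ j ∈ range k, b j * slidingSign t j :=
      sum_congr rfl fun j hj => by rw [hbβ j (mem_range.1 hj)]
    rw [hcongr, sum_mul_slidingSign b ht]
    change L k - L t - L (t + 1) = _
    simp only [hLs, hw]
    linear_combination (-(L k - 2 * L t)) * hsq t
  have hmod : ∀ t, w (t % k) = w t := by
    intro t
    have : ∀ j s, w (s + j * k) = w s := by
      intro j s
      induction j with
      | zero => simp
      | succ j ih => rw [add_mul, one_mul, ← add_assoc, hwper, ih]
    conv_rhs => rw [← Nat.mod_add_div t k, mul_comm k]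
    rw [this]
  have hbmod : ∀ t, b (t % k) = b t := fun t => by simp [hb]
  refine ⟨?_, ?_⟩
  · obtain ⟨t, ht⟩ := exists_eq_of_odd_period hk hb01 hwrec hwper
    refine ⟨t % k, Nat.mod_lt _ hkpos, ?_⟩
    rw [hsum _ (Nat.mod_lt _ hkpos), hmod, hbmod, ht]
    ring
  · rintro ⟨t₀, ht₀k, ht₀⟩ ⟨t₁, ht₁k, ht₁⟩ c hc
    obtain ⟨⟨s, hs⟩, t, ht⟩ := exists_eq_add_of_odd_period hk hb01 hwrec hwper hbper
      ⟨t₀, by rw [hbβ _ ht₀k, ht₀]⟩ ⟨t₁, by rw [hbβ _ ht₁k, ht₁]⟩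
    rcases hc with rfl | rfl
    · refine ⟨t % k, Nat.mod_lt _ hkpos, ?_⟩
      rw [hsum _ (Nat.mod_lt _ hkpos), hmod, hbmod, ht]
      ring
    · refine ⟨s % k, Nat.mod_lt _ hkpos, ?_⟩
      rw [hsum _ (Nat.mod_lt _ hkpos), hmod, hbmod, hs]
      ring

lemma bisects_of_sum_eq_zero {n : ℕ} {X : Fin n → ℤ} {A : Finset (Fin n)}
    (hX : ∀ i, X i = -1 ∨ X i = 0 ∨ X i = 1) (hsum : ∑ i ∈ A, X i = 0)
    (hne : ∃ i ∈ A, X i ≠ 0) : Bisects X A := by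
  have key : ∑ i ∈ A, X i =
      ((A.filter fun i => X i = 1).card : ℤ) - (A.filter fun i => X i = -1).card := by
    rw [card_filter, card_filter]
    push_cast
    rw [← sum_sub_distrib]
    refine sum_congr rfl fun i _ => ?_
    rcases hX i with h | h | h <;> simp [h]
  have heq : (A.filter fun i => X i = 1).card = (A.filter fun i => X i = -1).card := by
    rw [hsum] at key
    omega
  refine ⟨heq, fun h0 => ?_⟩
  obtain ⟨i, hi, hXi⟩ := hne
  rw [h0] at heq
  rw [card_eq_zero, filter_eq_empty_iff] at h0
  rw [eq_comm, card_eq_zero, filter_eq_empty_iff] at heq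
  have h1 := h0 hi
  have h2 := heq hi
  rcases hX i with h | h | h <;> contradiction

lemma slidingSign_eq_or (t j : ℕ) :
    slidingSign t j = -1 ∨ slidingSign t j = 0 ∨ slidingSign t j = 1 := by
  unfold slidingSign
  rcases neg_one_pow_eq_or ℤ j with h | h <;> split_ifs <;> simp [h]

lemma slidingSign_ne_zero_iff {t j : ℕ} : slidingSign t j ≠ 0 ↔ j ≠ t := by
  unfold slidingSign
  split_ifs with h <;> simp [h]

/-- The `t`-th coloring of a block: a sliding alternating coloring of `P`, with the fillers `F`
switching their signs at every step. -/
def blockColoring {n : ℕ} (P F : Finset (Fin n)) (ε : Fin n → ℤ) (idx : Fin n → ℕ) (t : ℕ)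
    (i : Fin n) : ℤ :=
  if i ∈ P then slidingSign t (idx i) else if i ∈ F then ε i * (-1) ^ t else 0

lemma sum_blockColoring {n : ℕ} {P F : Finset (Fin n)} (ε : Fin n → ℤ) (idx : Fin n → ℕ) (t : ℕ)
    (hdisj : Disjoint P F) (A : Finset (Fin n)) :
    ∑ i ∈ A, blockColoring P F ε idx t i =
      ∑ i ∈ A ∩ P, slidingSign t (idx i) + (∑ f ∈ A ∩ F, ε f) * (-1) ^ t := by
  rw [← filter_mem_eq_inter, ← filter_mem_eq_inter, sum_filter, sum_filter, sum_mul,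
    ← sum_add_distrib]
  refine sum_congr rfl fun i _ => ?_
  unfold blockColoring
  by_cases h1 : i ∈ P
  · simp [h1, disjoint_left.1 hdisj h1]
  · by_cases h2 : i ∈ F <;> simp [h1, h2]

lemma isBicoloring_blockColoring {n d : ℕ} {P F : Finset (Fin n)} {ε : Fin n → ℤ}
    {idx : Fin n → ℕ} {t : ℕ} (hε : ∀ f ∈ F, ε f = 1 ∨ ε f = -1) (hdisj : Disjoint P F)
    (hcard : P.card + F.card = d + 1) {x : Fin n} (hx : x ∈ P)
    (hidx : ∀ i ∈ P, idx i = t ↔ i = x) : IsBicoloring d (blockColoring P F ε idx t) := by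
  constructor
  · intro i
    unfold blockColoring
    split_ifs with h1 h2
    · exact slidingSign_eq_or _ _
    · rcases hε i h2 with h | h <;> rcases neg_one_pow_eq_or ℤ t with h' | h' <;> simp [h, h']
    · simp
  · have : (univ.filter fun i => blockColoring P F ε idx t i ≠ 0) = P.erase x ∪ F := by
      ext i
      simp only [mem_filter, mem_univ, true_and, mem_union, mem_erase]
      unfold blockColoring
      by_cases h1 : i ∈ P
      · simp only [h1, if_true, slidingSign_ne_zero_iff, ne_eq, hidx i h1, and_true,
          disjoint_left.1 hdisj h1, or_false]
      · by_cases h2 : i ∈ F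
        · rcases hε i h2 with h | h <;> simp [h1, h2, h]
        · simp [h1, h2]
    rw [this, card_union_of_disjoint (hdisj.mono_left (erase_subset _ _)), card_erase_of_mem hx]
    have := card_pos.2 ⟨x, hx⟩
    omega

/-- The colorings of a block. -/
lemma exists_block {n d : ℕ} (P F : Finset (Fin n)) (ε : Fin n → ℤ)
    (hε : ∀ f ∈ F, ε f = 1 ∨ ε f = -1) (hk : Odd P.card) (hdisj : Disjoint P F)
    (hcard : P.card + F.card = d + 1) :
    ∃ 𝒳 : Finset (Fin n → ℤ), 𝒳.card ≤ P.card ∧ (∀ X ∈ 𝒳, IsBicoloring d X) ∧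
      (∀ A, ∑ f ∈ A ∩ F, ε f = 0 → 2 ≤ (A ∩ P).card → ∃ X ∈ 𝒳, Bisects X A) ∧
      (∀ A, (∑ f ∈ A ∩ F, ε f = 1 ∨ ∑ f ∈ A ∩ F, ε f = -1) → (A ∩ P).Nonempty → ¬P ⊆ A →
        ∃ X ∈ 𝒳, Bisects X A) ∧
      (∀ A, ∑ f ∈ A ∩ F, ε f = 0 → (A ∩ F).Nonempty → (A ∩ P).card ≤ 1 →
        ∃ X ∈ 𝒳, Bisects X A) := by
  classical
  set k := P.card with hkdef
  let e := P.equivFin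
  let idx : Fin n → ℕ := fun i => if h : i ∈ P then e ⟨i, h⟩ else 0
  have hP : P.Nonempty := card_pos.1 hk.pos
  obtain ⟨x₀, hx₀⟩ := hP
  let p : ℕ → Fin n := fun j => if h : j < k then (e.symm ⟨j, h⟩ : P) else x₀
  have hpP : ∀ j < k, p j ∈ P := fun j hj => by simp [p, hj]
  have hidxp : ∀ j < k, idx (p j) = j := fun j hj => by
    have h1 := hpP j hj
    have h2 : (⟨p j, h1⟩ : P) = e.symm ⟨j, hj⟩ := by ext; simp [p, hj]
    simp only [idx, h1, dite_true, h2, Equiv.apply_symm_apply]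
  have hidxlt : ∀ i ∈ P, idx i < k := fun i hi => by
    simp only [idx, hi, dite_true]
    exact (e ⟨i, hi⟩).2
  have hpidx : ∀ i ∈ P, p (idx i) = i := fun i hi => by
    have h1 := hidxlt i hi
    simp only [p, h1, dite_true]
    simp [idx, hi]
  have hbi : ∀ t < k, IsBicoloring d (blockColoring P F ε idx t) := fun t ht =>
    isBicoloring_blockColoring hε hdisj hcard (hpP t ht) fun i hi =>
      ⟨fun h => by rw [← h, hpidx i hi], fun h => by rw [h, hidxp t ht]⟩
  have hsum : ∀ (A : Finset (Fin n)) (t : ℕ), ∑ i ∈ A ∩ P, slidingSign t (idx i) =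
      ∑ j ∈ range k, (if p j ∈ A then 1 else 0) * slidingSign t j := by
    intro A t
    rw [inter_comm, ← filter_mem_eq_inter, sum_filter]
    refine sum_nbij' idx p (fun i hi => mem_range.2 (hidxlt i hi))
      (fun j hj => hpP j (mem_range.1 hj)) hpidx (fun j hj => hidxp j (mem_range.1 hj)) ?_
    intro i hi
    rw [hpidx i hi]
    split_ifs <;> simp
  have caught : ∀ (A : Finset (Fin n)) (t : ℕ), t < k →
      ∑ j ∈ range k, (if p j ∈ A then 1 else 0) * slidingSign t j
        + (∑ f ∈ A ∩ F, ε f) * (-1) ^ t = 0 →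
      ((∃ i ∈ A ∩ P, i ≠ p t) ∨ (A ∩ F).Nonempty) →
      ∃ X ∈ (range k).image (blockColoring P F ε idx), Bisects X A := by
    intro A t ht h0 hne
    refine ⟨_, mem_image_of_mem _ (mem_range.2 ht),
      bisects_of_sum_eq_zero (hbi t ht).1 ?_ ?_⟩
    · rw [sum_blockColoring ε idx t hdisj, hsum, h0]
    · rcases hne with ⟨i, hi, hit⟩ | ⟨i, hi⟩
      · rw [mem_inter] at hi
        refine ⟨i, hi.1, ?_⟩
        simp only [blockColoring, hi.2, if_true, slidingSign_ne_zero_iff]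
        intro h
        exact hit (by rw [← h, hpidx i hi.2])
      · rw [mem_inter] at hi
        refine ⟨i, hi.1, ?_⟩
        simp only [blockColoring, disjoint_right.1 hdisj hi.2, hi.2, if_true, if_false]
        rcases hε i hi.2 with h | h <;> simp [h]
  have hβ : ∀ (A : Finset (Fin n)) (j : ℕ),
      (if p j ∈ A then (1 : ℤ) else 0) = 0 ∨ (if p j ∈ A then (1 : ℤ) else 0) = 1 := by
    intro A j
    split_ifs <;> simp
  refine ⟨(range k).image (blockColoring P F ε idx), card_image_le.trans (by simp), ?_, ?_, ?_, ?_⟩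
  · intro X hX
    obtain ⟨t, ht, rfl⟩ := mem_image.1 hX
    exact hbi t (mem_range.1 ht)
  · intro A hc h2
    obtain ⟨t, ht, h0⟩ := (sliding_values hk _ (hβ A)).1
    refine caught A t ht (by rw [h0, hc]; simp) (Or.inl ?_)
    obtain ⟨i, hi, hne⟩ := exists_mem_ne h2 (p t)
    exact ⟨i, hi, hne⟩
  · rintro A hc ⟨x, hx⟩ hPA
    rw [mem_inter] at hx
    obtain ⟨y, hyP, hyA⟩ := not_subset.1 hPA
    obtain ⟨t, ht, h0⟩ := (sliding_values hk _ (hβ A)).2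
      ⟨idx y, hidxlt y hyP, by simp [hpidx y hyP, hyA]⟩
      ⟨idx x, hidxlt x hx.2, by simp [hpidx x hx.2, hx.1]⟩ _ hc
    refine caught A t ht h0 (Or.inr ?_)
    by_contra hemp
    rw [not_nonempty_iff_eq_empty] at hemp
    rw [hemp] at hc
    simp at hc
  · intro A hc hne h1
    obtain ⟨x, hxP, hx⟩ : ∃ x ∈ P, ∀ i ∈ A ∩ P, i = x := by
      rcases (A ∩ P).eq_empty_or_nonempty with h | ⟨x, hx⟩
      · exact ⟨x₀, hx₀, by simp [h]⟩
      · exact ⟨x, (mem_inter.1 hx).2, fun i hi => card_le_one.1 h1 i hi x hx⟩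
    refine caught A (idx x) (hidxlt x hxP) ?_ (Or.inr hne)
    rw [hc, ← hsum, zero_mul, add_zero]
    refine sum_eq_zero fun i hi => ?_
    rw [hx i hi]
    simp [slidingSign]

/-- Four colorings catching the sets that meet each of two given sets in one point. -/
lemma exists_cross_family {n d : ℕ} (P₁ P₂ : Finset (Fin n))
    (hle : P₁.card + P₂.card ≤ 2 * d - 2) (hd : 1 ≤ d) (hU : d ≤ (P₁ ∪ P₂).card) :
    ∃ 𝒳 : Finset (Fin n → ℤ), 𝒳.card ≤ 4 ∧ (∀ X ∈ 𝒳, IsBicoloring d X) ∧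
      ∀ A, (A ∩ P₁).card ≤ 1 → (A ∩ P₂).card ≤ 1 → 2 ≤ (A ∩ (P₁ ∪ P₂)).card →
        ∃ X ∈ 𝒳, Bisects X A := by
  classical
  have hpad : ∀ U ⊆ P₁, ∀ W ⊆ P₂, U.card + W.card ≤ d →
      ∃ S, U ⊆ S ∧ W ⊆ S ∧ S ⊆ P₁ ∪ P₂ ∧ S.card = d := by
    intro U hU' W hW' hc
    obtain ⟨S, h1, h2, h3⟩ := exists_subsuperset_card_eq (union_subset_union hU' hW')
      ((card_union_le U W).trans hc) hU
    exact ⟨S, subset_union_left.trans h1, subset_union_right.trans h1, h2, h3⟩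
  obtain ⟨U, hUP, hUc⟩ := exists_subset_card_eq (Nat.div_le_self P₁.card 2)
  obtain ⟨W, hWP, hWc⟩ := exists_subset_card_eq (Nat.div_le_self P₂.card 2)
  have hU' := card_sdiff_add_card_eq_card hUP
  have hW' := card_sdiff_add_card_eq_card hWP
  obtain ⟨S₁, hS₁⟩ := hpad U hUP W hWP (by omega)
  obtain ⟨S₂, hS₂⟩ := hpad U hUP (P₂ \ W) sdiff_subset (by omega)
  obtain ⟨S₃, hS₃⟩ := hpad (P₁ \ U) sdiff_subset W hWP (by omega)
  obtain ⟨S₄, hS₄⟩ := hpad (P₁ \ U) sdiff_subset (P₂ \ W) sdiff_subset (by omega)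
  let col : Finset (Fin n) → Fin n → ℤ := fun S i =>
    if i ∈ S then (if i ∈ P₁ then 1 else -1) else 0
  have hcol : ∀ S i, col S i = -1 ∨ col S i = 0 ∨ col S i = 1 := by
    intro S i
    simp only [col]
    split_ifs <;> simp
  have hbi : ∀ S, S.card = d → IsBicoloring d (col S) := by
    intro S hS
    refine ⟨hcol S, ?_⟩
    rw [← hS]
    congr 1
    ext i
    simp only [mem_filter, mem_univ, true_and, col]
    split_ifs <;> simp_all
  refine ⟨({S₁, S₂, S₃, S₄} : Finset (Finset (Fin n))).image col,
    card_image_le.trans card_le_four, ?_, ?_⟩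
  · intro X hX
    obtain ⟨S, hS, rfl⟩ := mem_image.1 hX
    simp only [mem_insert, mem_singleton] at hS
    rcases hS with rfl | rfl | rfl | rfl
    exacts [hbi _ hS₁.2.2.2, hbi _ hS₂.2.2.2, hbi _ hS₃.2.2.2, hbi _ hS₄.2.2.2]
  · intro A h1 h2 h3
    rw [inter_union_distrib_left] at h3
    have h4 := card_union_le (A ∩ P₁) (A ∩ P₂)
    obtain ⟨x, hx⟩ := card_eq_one.1 (show (A ∩ P₁).card = 1 by omega)
    obtain ⟨y, hy⟩ := card_eq_one.1 (show (A ∩ P₂).card = 1 by omega)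
    have hxA : x ∈ A ∧ x ∈ P₁ := mem_inter.1 (hx ▸ mem_singleton_self x)
    have hyA : y ∈ A ∧ y ∈ P₂ := mem_inter.1 (hy ▸ mem_singleton_self y)
    have hxy : x ≠ y := by
      rintro rfl
      rw [hx, hy] at h3
      simp at h3
    have hyP : y ∉ P₁ := fun h =>
      hxy (mem_singleton.1 (hx ▸ mem_inter.2 ⟨hyA.1, h⟩ : y ∈ ({x} : Finset _))).symm
    have hbis : ∀ S, S ⊆ P₁ ∪ P₂ → x ∈ S → y ∈ S → Bisects (col S) A := by
      intro S hS hxS hyS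
      refine bisects_of_sum_eq_zero (hcol S) ?_ ⟨x, hxA.1, by simp [col, hxS, hxA.2]⟩
      have hsub : ({x, y} : Finset (Fin n)) ⊆ A := by
        intro i hi
        rcases mem_insert.1 hi with rfl | hi
        · exact hxA.1
        · rw [mem_singleton.1 hi]; exact hyA.1
      rw [← sum_subset hsub, sum_pair hxy]
      · simp [col, hxS, hyS, hxA.2, hyP]
      · intro i hi hixy
        have : i ∉ S := by
          intro hiS
          apply hixy
          rcases mem_union.1 (hS hiS) with h | h
          · have : i ∈ A ∩ P₁ := mem_inter.2 ⟨hi, h⟩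
            rw [hx, mem_singleton] at this
            simp [this]
          · have : i ∈ A ∩ P₂ := mem_inter.2 ⟨hi, h⟩
            rw [hy, mem_singleton] at this
            simp [this]
        simp [col, this]
    by_cases hxU : x ∈ U <;> by_cases hyW : y ∈ W
    · exact ⟨_, mem_image_of_mem _ (by simp), hbis S₁ hS₁.2.2.1 (hS₁.1 hxU) (hS₁.2.1 hyW)⟩
    · exact ⟨_, mem_image_of_mem _ (by simp), hbis S₂ hS₂.2.2.1 (hS₂.1 hxU)
        (hS₂.2.1 (mem_sdiff.2 ⟨hyA.2, hyW⟩))⟩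
    · exact ⟨_, mem_image_of_mem _ (by simp), hbis S₃ hS₃.2.2.1
        (hS₃.1 (mem_sdiff.2 ⟨hxA.2, hxU⟩)) (hS₃.2.1 hyW)⟩
    · exact ⟨_, mem_image_of_mem _ (by simp), hbis S₄ hS₄.2.2.1
        (hS₄.1 (mem_sdiff.2 ⟨hxA.2, hxU⟩)) (hS₄.2.1 (mem_sdiff.2 ⟨hyA.2, hyW⟩))⟩

/-- At most `N` bicolorings of order `d` suffice to bisect every set meeting `R` in at least `q`
points or `R₀` in at least two points, and, when `d` is odd, not containing `R`. -/
def IsBisectable {n : ℕ} (d : ℕ) (R₀ R : Finset (Fin n)) (q N : ℕ) : Prop :=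
  ∃ 𝒳 : Finset (Fin n → ℤ), 𝒳.card ≤ N ∧ (∀ X ∈ 𝒳, IsBicoloring d X) ∧
    ∀ A, (Odd d → ¬R ⊆ A) → (q ≤ (A ∩ R).card ∨ 2 ≤ (A ∩ R₀).card) → ∃ X ∈ 𝒳, Bisects X A

lemma IsBisectable.union {n d : ℕ} {R₀ R T : Finset (Fin n)} {q N : ℕ}
    (h : IsBisectable d R₀ R q N) (hR : R₀ ⊆ R) (hR₀ : d ≤ R₀.card) (hd : 2 ≤ d)
    (hRT : Disjoint R T) (hT : T.Nonempty) (hTd : T.card ≤ d - 1) :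
    IsBisectable d R₀ (R ∪ T) (q + 1) (N + (d + 1)) := by
  classical
  have hTpos := hT.card_pos
  obtain ⟨Q, F, hQR, hFR, hQF, hQ, hodd, hcard, hF1, hFne⟩ :
      ∃ Q F : Finset (Fin n), Q ⊆ R₀ ∧ F ⊆ R₀ ∧ Disjoint Q F ∧ Q.Nonempty ∧
        Odd (T.card + Q.card) ∧ T.card + Q.card + F.card = d + 1 ∧ F.card ≤ 1 ∧
        (Odd d → F.Nonempty) := by
    rcases Nat.even_or_odd d with he | ho
    · obtain ⟨Q, hQ, hQc⟩ := exists_subset_card_eq (show d + 1 - T.card ≤ R₀.card by omega)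
      refine ⟨Q, ∅, hQ, by simp, by simp, card_pos.1 (by omega), ?_, by simp; omega, by simp, ?_⟩
      · rw [show T.card + Q.card = d + 1 by omega]
        exact he.add_one
      · exact fun ho => absurd he (Nat.not_even_iff_odd.2 ho)
    · obtain ⟨Q, hQ, hQc⟩ := exists_subset_card_eq (show d - T.card ≤ R₀.card by omega)
      have := card_sdiff_add_card_eq_card hQ
      obtain ⟨a, ha⟩ : (R₀ \ Q).Nonempty := card_pos.1 (by omega)
      rw [mem_sdiff] at ha
      refine ⟨Q, {a}, hQ, by simpa using ha.1, by simpa using ha.2, card_pos.1 (by omega), ?_,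
        by rw [card_singleton]; omega, by simp, by simp⟩
      rw [show T.card + Q.card = d by omega]
      exact ho
  have hTR₀ : Disjoint T R₀ := (hRT.mono_left hR).symm
  have hPc : (T ∪ Q).card = T.card + Q.card :=
    card_union_of_disjoint (hTR₀.mono_right hQR)
  obtain ⟨𝒴, hYc, hYb, hY1, hY2, -⟩ := exists_block (d := d) (T ∪ Q) F (fun _ => 1) (by simp)
    (by rwa [hPc]) (disjoint_union_left.2 ⟨hTR₀.mono_right hFR, hQF⟩) (by omega)
  obtain ⟨𝒳, hXc, hXb, hX⟩ := h
  refine ⟨𝒳 ∪ 𝒴, (card_union_le _ _).trans (by omega), ?_, ?_⟩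
  · intro X hX'
    rcases mem_union.1 hX' with h' | h'
    exacts [hXb X h', hYb X h']
  intro A hA hq
  have left : (∃ X ∈ 𝒳, Bisects X A) → ∃ X ∈ 𝒳 ∪ 𝒴, Bisects X A :=
    fun ⟨X, hX, hb⟩ => ⟨X, mem_union_left _ hX, hb⟩
  have right : (∃ X ∈ 𝒴, Bisects X A) → ∃ X ∈ 𝒳 ∪ 𝒴, Bisects X A :=
    fun ⟨X, hX, hb⟩ => ⟨X, mem_union_right _ hX, hb⟩
  have hsum : ∑ f ∈ A ∩ F, (1 : ℤ) = (A ∩ F).card := by simp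
  by_cases h2 : 2 ≤ (A ∩ R₀).card
  · by_cases hRA : Odd d → ¬R ⊆ A
    · exact left (hX A hRA (Or.inr h2))
    · push Not at hRA
      obtain ⟨hdo, hRA⟩ := hRA
      have hTA : ¬T ⊆ A := fun h => hA hdo (union_subset hRA h)
      refine right (hY2 A (Or.inl ?_) ?_ fun h => hTA (subset_union_left.trans h))
      · rw [hsum, inter_eq_right.2 ((hFR.trans hR).trans hRA)]
        have := (hFne hdo).card_pos
        exact_mod_cast (by omega : F.card = 1)
      · obtain ⟨o, ho⟩ := hQ
        exact ⟨o, mem_inter.2 ⟨hRA (hR (hQR ho)), mem_union_right _ ho⟩⟩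
  · have hq' : q + 1 ≤ (A ∩ (R ∪ T)).card := hq.resolve_right h2
    have hRA : Odd d → ¬R ⊆ A := fun _ hRA => h2 (by
      rw [inter_eq_right.2 (hR.trans hRA)]; omega)
    by_cases hP : 2 ≤ (A ∩ (T ∪ Q)).card
    · by_cases hAF : (A ∩ F).card = 0
      · exact right (hY1 A (by rw [hsum, hAF]; rfl) hP)
      · have hle := card_le_card (inter_subset_right (s₁ := A) (s₂ := F))
        refine right (hY2 A (Or.inl ?_) (card_pos.1 (by omega)) fun hPA => h2 ?_)
        · rw [hsum]
          exact_mod_cast (by omega : (A ∩ F).card = 1)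
        · obtain ⟨a, ha⟩ := card_pos.1 (Nat.pos_of_ne_zero hAF)
          obtain ⟨o, ho⟩ := hQ
          rw [mem_inter] at ha
          refine one_lt_card.2 ⟨a, mem_inter.2 ⟨ha.1, hFR ha.2⟩, o,
            mem_inter.2 ⟨hPA (mem_union_right _ ho), hQR ho⟩, ?_⟩
          rintro rfl
          exact disjoint_left.1 hQF ho ha.2
    · have h3 : (A ∩ T).card ≤ (A ∩ (T ∪ Q)).card :=
        card_le_card (inter_subset_inter_left subset_union_left)
      have h4 := card_union_le (A ∩ R) (A ∩ T)
      rw [← inter_union_distrib_left] at h4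
      exact left (hX A hRA (Or.inl (by omega)))

lemma IsBisectable.mono {n d : ℕ} {R₀ R : Finset (Fin n)} {q q' N N' : ℕ}
    (h : IsBisectable d R₀ R q N) (hq : q ≤ q') (hN : N ≤ N') : IsBisectable d R₀ R q' N' := by
  obtain ⟨𝒳, h1, h2, h3⟩ := h
  exact ⟨𝒳, h1.trans hN, h2, fun A hA h => h3 A hA (h.imp_left hq.trans)⟩

lemma IsBisectable.extend_univ {n d : ℕ} {R₀ : Finset (Fin n)} (hR₀ : d ≤ R₀.card) (hd : 2 ≤ d)
    (j : ℕ) : ∀ (R : Finset (Fin n)) (q N : ℕ), IsBisectable d R₀ R q N → R₀ ⊆ R →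
      n ≤ R.card + j * (d - 1) → IsBisectable d R₀ univ (q + j) (N + j * (d + 1)) := by
  classical
  induction j with
  | zero =>
    intro R q N h _ hn
    have hle := card_le_univ R
    rw [Fintype.card_fin] at hle
    have hR : R = univ := (card_eq_iff_eq_univ R).1 (by rw [Fintype.card_fin]; omega)
    simpa [hR] using h
  | succ j ih =>
    intro R q N h hR hn
    have hc : Rᶜ.card = n - R.card := by rw [card_compl, Fintype.card_fin]
    obtain ⟨T, hT, hTc⟩ := exists_subset_card_eq (min_le_left Rᶜ.card (d - 1))
    have hdis : Disjoint R T := disjoint_compl_right.mono_right hT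
    rw [add_mul, one_mul] at hn
    rcases T.eq_empty_or_nonempty with rfl | hTne
    · rw [card_empty] at hTc
      refine (ih R q N h hR ?_).mono (by omega) ?_
      · have : n ≤ R.card := by omega
        omega
      · nlinarith
    · have h1 := ih (R ∪ T) (q + 1) (N + (d + 1))
        (h.union hR hR₀ hd hdis hTne (by omega)) (hR.trans subset_union_left) ?_
      · refine h1.mono (by omega) ?_
        rw [add_mul, one_mul]
        omega
      · rw [card_union_of_disjoint hdis, hTc, hc]
        have : R.card ≤ n := by simpa using card_le_univ R
        omega

lemma sum_inter_pair {n : ℕ} (A : Finset (Fin n)) {a b : Fin n} (hab : a ≠ b) :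
    ∑ f ∈ A ∩ {a, b}, (if f = b then (-1 : ℤ) else 1) =
      (if a ∈ A then 1 else 0) - (if b ∈ A then 1 else 0) := by
  rw [inter_comm, ← sum_ite_mem, sum_pair hab]
  simp only [hab, if_true, if_false]
  split_ifs <;> simp

lemma sum_inter_triple {n : ℕ} (A : Finset (Fin n)) {a b c : Fin n} (hab : a ≠ b) (hac : a ≠ c)
    (hbc : b ≠ c) :
    ∑ f ∈ A ∩ {a, b, c}, (if f = c then (-1 : ℤ) else 1) =
      (if a ∈ A then 1 else 0) + (if b ∈ A then 1 else 0) - (if c ∈ A then 1 else 0) := by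
  rw [inter_comm, ← sum_ite_mem, sum_insert (by simp [hab, hac]), sum_pair hbc]
  simp only [hac, hbc, if_true, if_false]
  split_ifs <;> simp

lemma sum_inter_singleton {n : ℕ} (A : Finset (Fin n)) (a : Fin n) :
    ∑ _f ∈ A ∩ {a}, (1 : ℤ) = if a ∈ A then 1 else 0 := by
  rw [inter_comm, ← sum_ite_mem, sum_singleton]

/-- A single block of `d + 1` bicolorings. -/
lemma exists_isBisectable_of_lt {n d : ℕ} (hdn : d + 1 ≤ n) :
    ∃ R : Finset (Fin n), d ≤ R.card ∧ IsBisectable d R R 2 (d + 1) := by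
  classical
  rcases Nat.even_or_odd d with he | ho
  · obtain ⟨P, -, hP⟩ := exists_subset_card_eq
      (show d + 1 ≤ (univ : Finset (Fin n)).card by simpa using hdn)
    obtain ⟨𝒳, hc, hb, h1, -, -⟩ := exists_block (d := d) P ∅ (fun _ => 1) (by simp)
      (by rw [hP]; exact he.add_one) (by simp) (by simp [hP])
    exact ⟨P, by omega, 𝒳, by omega, hb, fun A _ hA => h1 A (by simp) (by simpa using hA)⟩
  · obtain ⟨P, -, hP⟩ := exists_subset_card_eq
      (show d ≤ (univ : Finset (Fin n)).card by simpa using (Nat.le_succ d).trans hdn)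
    obtain ⟨a, ha⟩ : (univ \ P).Nonempty := by
      rw [← card_pos, card_sdiff_of_subset (subset_univ P), card_univ, Fintype.card_fin]
      omega
    rw [mem_sdiff] at ha
    obtain ⟨𝒳, hc, hb, h1, h2, -⟩ := exists_block (d := d) P {a} (fun _ => 1) (by simp)
      (by rwa [hP]) (by simpa using ha.2) (by simp [hP])
    refine ⟨P, hP.ge, 𝒳, by omega, hb, fun A hPA hA => ?_⟩
    rw [or_self] at hA
    by_cases haA : a ∈ A
    · exact h2 A (Or.inl (by rw [sum_inter_singleton, if_pos haA])) (card_pos.1 (by omega)) (hPA ho)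
    · exact h1 A (by rw [sum_inter_singleton, if_neg haA]) hA

/-- Two overlapping blocks together with four cross colorings. -/
lemma exists_isBisectable_of_le {n d : ℕ} {R : Finset (Fin n)} (hd : 3 ≤ d)
    (h1 : d + 1 ≤ R.card) (h2 : R.card ≤ 2 * d - 2) :
    IsBisectable d R R 2 (2 * (d + 1)) := by
  classical
  obtain ⟨P₁, P₂, hU, hcard, hd1, 𝒳₁, 𝒳₂, hc₁, hc₂, hb₁, hb₂, hX⟩ :
      ∃ P₁ P₂ : Finset (Fin n), P₁ ∪ P₂ = R ∧ P₁.card + P₂.card = 2 * d - 2 ∧ 1 ≤ d ∧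
        ∃ 𝒳₁ 𝒳₂ : Finset (Fin n → ℤ), 𝒳₁.card ≤ P₁.card ∧ 𝒳₂.card ≤ P₂.card ∧
        (∀ X ∈ 𝒳₁, IsBicoloring d X) ∧ (∀ X ∈ 𝒳₂, IsBicoloring d X) ∧
        ∀ A, (Odd d → ¬R ⊆ A) → (2 ≤ (A ∩ P₁).card ∨ 2 ≤ (A ∩ P₂).card) →
          (∃ X ∈ 𝒳₁, Bisects X A) ∨ (∃ X ∈ 𝒳₂, Bisects X A) := by
    rcases Nat.even_or_odd d with he | ho
    · have hd4 : 4 ≤ d := by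
        obtain ⟨r, hr⟩ := he
        omega
      have hodd : Odd (d - 1) := Nat.Even.sub_odd (by omega) he odd_one
      obtain ⟨P₁, hP₁, hc₁⟩ := exists_subset_card_eq (show d - 1 ≤ R.card by omega)
      have hs := card_sdiff_add_card_eq_card hP₁
      obtain ⟨P₂, hRP, hP₂, hc₂⟩ := exists_subsuperset_card_eq (sdiff_subset (s := R) (t := P₁))
        (show (R \ P₁).card ≤ d - 1 by omega) (by omega)
      have hU : P₁ ∪ P₂ = R := by
        refine (union_subset hP₁ hP₂).antisymm fun i hi => ?_
        by_cases h : i ∈ P₁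
        · exact mem_union_left _ h
        · exact mem_union_right _ (hRP (mem_sdiff.2 ⟨hi, h⟩))
      have hc12 := card_union_add_card_inter P₁ P₂
      have hc21 := card_sdiff_add_card_inter P₂ P₁
      have hc12' := card_sdiff_add_card_inter P₁ P₂
      rw [inter_comm] at hc21
      rw [hU] at hc12
      obtain ⟨a, ha, b, hb, hab⟩ := one_lt_card.1 (show 1 < (P₂ \ P₁).card by omega)
      obtain ⟨a', ha', b', hb', hab'⟩ := one_lt_card.1 (show 1 < (P₁ \ P₂).card by omega)
      rw [mem_sdiff] at ha hb ha' hb'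
      obtain ⟨𝒳₁, hX₁, hb₁, hi₁, hii₁, hiii₁⟩ := exists_block (d := d) P₁ {a, b}
        (fun f => if f = b then -1 else 1) (by intro f _; split_ifs <;> simp)
        (by rwa [hc₁]) (by simp [ha.2, hb.2]) (by rw [card_pair hab]; omega)
      obtain ⟨𝒳₂, hX₂, hb₂, hi₂, hii₂, hiii₂⟩ := exists_block (d := d) P₂ {a', b'}
        (fun f => if f = b' then -1 else 1) (by intro f _; split_ifs <;> simp)
        (by rwa [hc₂]) (by simp [ha'.2, hb'.2]) (by rw [card_pair hab']; omega)
      simp only [sum_inter_pair _ hab] at hi₁ hii₁ hiii₁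
      simp only [sum_inter_pair _ hab'] at hi₂ hii₂ hiii₂
      refine ⟨P₁, P₂, hU, by omega, by omega, 𝒳₁, 𝒳₂, hX₁, hX₂, hb₁, hb₂, ?_⟩
      have key : ∀ {A P P' : Finset (Fin n)} {a b a' b' : Fin n} {C C' : Prop},
          (a ∈ P' ∧ a ∉ P) → (b ∈ P' ∧ b ∉ P) → (a' ∈ P ∧ a' ∉ P') → (b' ∈ P ∧ b' ∉ P') →
          ((if a ∈ A then (1 : ℤ) else 0) - (if b ∈ A then 1 else 0) = 0 →
            2 ≤ (A ∩ P).card → C) →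
          (((if a ∈ A then (1 : ℤ) else 0) - (if b ∈ A then 1 else 0) = 1 ∨
            (if a ∈ A then (1 : ℤ) else 0) - (if b ∈ A then 1 else 0) = -1) →
            (A ∩ P).Nonempty → ¬P ⊆ A → C) →
          ((if a' ∈ A then (1 : ℤ) else 0) - (if b' ∈ A then 1 else 0) = 0 →
            2 ≤ (A ∩ P').card → C') →
          ((if a' ∈ A then (1 : ℤ) else 0) - (if b' ∈ A then 1 else 0) = 0 →
            (A ∩ {a', b'}).Nonempty → (A ∩ P').card ≤ 1 → C') →
          2 ≤ (A ∩ P).card → C ∨ C' := by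
        intro A P P' a b a' b' C C' ha hb ha' hb' h1 h2 h3 h4 h
        by_cases hPA : P ⊆ A
        · right
          have hs : (if a' ∈ A then (1 : ℤ) else 0) - (if b' ∈ A then 1 else 0) = 0 := by
            simp [hPA ha'.1, hPA hb'.1]
          by_cases h' : 2 ≤ (A ∩ P').card
          · exact h3 hs h'
          · exact h4 hs ⟨a', by simp [hPA ha'.1]⟩ (by omega)
        · left
          by_cases hs : (if a ∈ A then (1 : ℤ) else 0) - (if b ∈ A then 1 else 0) = 0
          · exact h1 hs h
          · refine h2 ?_ (card_pos.1 (by omega)) hPA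
            split_ifs at hs ⊢ <;> simp_all
      intro A _ hA
      rcases hA with hA | hA
      · exact key ha hb ha' hb' (hi₁ A) (hii₁ A) (hi₂ A) (hiii₂ A) hA
      · exact (key ha' hb' ha hb (hi₂ A) (hii₂ A) (hi₁ A) (hiii₁ A) hA).symm
    · have hodd : Odd (d - 2) := Nat.Odd.sub_even (by omega) ho even_two
      obtain ⟨P₁, hP₁, hc₁⟩ := exists_subset_card_eq (show d ≤ R.card by omega)
      have hs := card_sdiff_add_card_eq_card hP₁
      obtain ⟨P₂, hRP, hP₂, hc₂⟩ := exists_subsuperset_card_eq (sdiff_subset (s := R) (t := P₁))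
        (show (R \ P₁).card ≤ d - 2 by omega) (by omega)
      have hU : P₁ ∪ P₂ = R := by
        refine (union_subset hP₁ hP₂).antisymm fun i hi => ?_
        by_cases h : i ∈ P₁
        · exact mem_union_left _ h
        · exact mem_union_right _ (hRP (mem_sdiff.2 ⟨hi, h⟩))
      have hc12 := card_union_add_card_inter P₁ P₂
      have hc12' := card_sdiff_add_card_inter P₁ P₂
      rw [hU] at hc12
      obtain ⟨a, ha'⟩ := card_pos.1 (show 0 < (R \ P₁).card by omega)
      have ha : a ∈ P₂ := hRP ha'
      rw [mem_sdiff] at ha'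
      obtain ⟨x, y, z, hx, hy, hz, hxy, hxz, hyz⟩ :=
        two_lt_card_iff.1 (show 2 < (P₁ \ P₂).card by omega)
      rw [mem_sdiff] at hx hy hz
      obtain ⟨𝒳₁, hX₁, hb₁, hi₁, hii₁, -⟩ := exists_block (d := d) P₁ {a}
        (fun _ => 1) (by simp) (by rwa [hc₁]) (by simp [ha'.2]) (by rw [card_singleton]; omega)
      obtain ⟨𝒳₂, hX₂, hb₂, hi₂, hii₂, -⟩ := exists_block (d := d) P₂ {x, y, z}
        (fun f => if f = z then -1 else 1) (by intro f _; split_ifs <;> simp)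
        (by rwa [hc₂]) (by simp [hx.2, hy.2, hz.2])
        (by rw [card_eq_three.2 ⟨x, y, z, hxy, hxz, hyz, rfl⟩]; omega)
      simp only [sum_inter_singleton] at hi₁ hii₁
      simp only [sum_inter_triple _ hxy hxz hyz] at hi₂ hii₂
      refine ⟨P₁, P₂, hU, by omega, by omega, 𝒳₁, 𝒳₂, hX₁, hX₂, hb₁, hb₂, ?_⟩
      intro A hRA hA
      specialize hi₁ A
      specialize hii₁ A
      specialize hi₂ A
      specialize hii₂ A
      have hPP : P₁ ⊆ A → ¬P₂ ⊆ A := fun h h' => hRA ho (hU ▸ union_subset h h')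
      by_cases h1 : 2 ≤ (A ∩ P₁).card
      · have hne : (A ∩ P₁).Nonempty := card_pos.1 (by omega)
        by_cases haA : a ∈ A
        · by_cases hPA : P₁ ⊆ A
          · right
            exact hii₂ (by simp [hPA hx.1, hPA hy.1, hPA hz.1]) ⟨a, mem_inter.2 ⟨haA, ha⟩⟩ (hPP hPA)
          · exact Or.inl (hii₁ (by simp [haA]) hne hPA)
        · exact Or.inl (hi₁ (by simp [haA]) h1)
      · have h2 : 2 ≤ (A ∩ P₂).card := hA.resolve_left h1
        have hne : (A ∩ P₂).Nonempty := card_pos.1 (by omega)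
        have huniq : ∀ u v, u ∈ P₁ → v ∈ P₁ → u ≠ v → u ∈ A → v ∉ A := fun u v hu hv huv huA hvA =>
          h1 (one_lt_card.2 ⟨u, mem_inter.2 ⟨huA, hu⟩, v, mem_inter.2 ⟨hvA, hv⟩, huv⟩)
        have hP₁A : ¬P₁ ⊆ A := fun h => huniq x y hx.1 hy.1 hxy (h hx.1) (h hy.1)
        have hxy' := huniq x y hx.1 hy.1 hxy
        have hxz' := huniq x z hx.1 hz.1 hxz
        have hyz' := huniq y z hy.1 hz.1 hyz
        by_cases hs : x ∈ A ∨ y ∈ A ∨ z ∈ A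
        · by_cases hPA : P₂ ⊆ A
          · refine Or.inl (hii₁ (by simp [hPA ha]) ?_ hP₁A)
            rcases hs with h | h | h
            exacts [⟨x, mem_inter.2 ⟨h, hx.1⟩⟩, ⟨y, mem_inter.2 ⟨h, hy.1⟩⟩,
              ⟨z, mem_inter.2 ⟨h, hz.1⟩⟩]
          · refine Or.inr (hii₂ ?_ hne hPA)
            by_cases hxA : x ∈ A <;> by_cases hyA : y ∈ A <;> by_cases hzA : z ∈ A <;> simp_all
        · push Not at hs
          exact Or.inr (hi₂ (by simp [hs]) h2)
  obtain ⟨𝒳₃, hc₃, hb₃, hX₃⟩ := exists_cross_family P₁ P₂ hcard.le hd1 (by rw [hU]; omega)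
  refine ⟨𝒳₁ ∪ 𝒳₂ ∪ 𝒳₃, ?_, ?_, ?_⟩
  · have h3 := card_union_le (𝒳₁ ∪ 𝒳₂) 𝒳₃
    have h4 := card_union_le 𝒳₁ 𝒳₂
    omega
  · intro X hX
    simp only [mem_union] at hX
    rcases hX with (h | h) | h
    exacts [hb₁ X h, hb₂ X h, hb₃ X h]
  · intro A hRA hA
    rw [or_self, ← hU] at hA
    by_cases h : 2 ≤ (A ∩ P₁).card ∨ 2 ≤ (A ∩ P₂).card
    · rcases hX A hRA h with ⟨X, h, h'⟩ | ⟨X, h, h'⟩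
      · exact ⟨X, mem_union_left _ (mem_union_left _ h), h'⟩
      · exact ⟨X, mem_union_left _ (mem_union_right _ h), h'⟩
    · obtain ⟨X, h, h'⟩ := hX₃ A (by omega) (by omega) hA
      exact ⟨X, mem_union_right _ h, h'⟩

/-- The `n + 1` threshold colorings bisect every nonempty set of even size. -/
lemma exists_threshold_family (n : ℕ) :
    ∃ 𝒳 : Finset (Fin n → ℤ), 𝒳.card ≤ n + 1 ∧ (∀ X ∈ 𝒳, IsBicoloring n X) ∧
      ∀ A, Even A.card → A.Nonempty → ∃ X ∈ 𝒳, Bisects X A := by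
  classical
  let col : ℕ → Fin n → ℤ := fun j i => if i.val < j then 1 else -1
  have hcol : ∀ j i, col j i = -1 ∨ col j i = 0 ∨ col j i = 1 := by
    intro j i
    simp only [col]
    split_ifs <;> simp
  have hne : ∀ j i, col j i ≠ 0 := by
    intro j i
    simp only [col]
    split_ifs <;> simp
  refine ⟨(range (n + 1)).image col, card_image_le.trans (card_range _).le, ?_, ?_⟩
  · intro X hX
    obtain ⟨j, -, rfl⟩ := mem_image.1 hX
    exact ⟨hcol j, by simp [hne]⟩
  · intro A hA hAne
    let h : ℕ → ℕ := fun j => (A.filter fun i => i.val < j).card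
    have hn : h n = A.card := by simp [h]
    have hstep : ∀ j, h (j + 1) ≤ h j + 1 := by
      intro j
      have hsub : (A.filter fun i => i.val < j + 1) ⊆
          (A.filter fun i => i.val < j) ∪ (A.filter fun i => i.val = j) := by
        intro i
        simp only [mem_union, mem_filter]
        rintro ⟨h1, h2⟩
        rcases Nat.lt_succ_iff_lt_or_eq.1 h2 with h3 | h3
        exacts [Or.inl ⟨h1, h3⟩, Or.inr ⟨h1, h3⟩]
      have hone : (A.filter fun i => i.val = j).card ≤ 1 := by
        refine card_le_one.2 fun u hu v hv => Fin.ext ?_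
        rw [(mem_filter.1 hu).2, (mem_filter.1 hv).2]
      exact (card_le_card hsub).trans ((card_union_le _ _).trans (by simp only [h]; omega))
    obtain ⟨r, hr⟩ := hA
    have hex : ∃ j, r ≤ h j := ⟨n, by omega⟩
    have hj := Nat.find_spec hex
    have hle : h (Nat.find hex) ≤ r := by
      rcases Nat.eq_zero_or_eq_succ_pred (Nat.find hex) with h0 | h0
      · rw [h0]
        simp [h]
      · have := Nat.find_min hex (m := (Nat.find hex).pred) (by omega)
        have := hstep (Nat.find hex).pred
        rw [← Nat.succ_eq_add_one, ← h0] at this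
        omega
    have hjn : Nat.find hex ≤ n := Nat.find_min' hex (by omega)
    generalize Nat.find hex = j at hj hle hjn
    refine ⟨col j, mem_image_of_mem _ (by simp; omega), bisects_of_sum_eq_zero (hcol j) ?_ ?_⟩
    · have hsplit := card_filter_add_card_filter_not (s := A) (fun i : Fin n => i.val < j)
      have hhj : (A.filter fun i => i.val < j).card = r := le_antisymm hle hj
      simp only [col]
      rw [sum_ite, sum_const, sum_const, hhj,
        show (A.filter fun i => ¬i.val < j).card = r by omega]
      simp
    · obtain ⟨i, hi⟩ := hAne
      exact ⟨i, hi, hne j i⟩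

lemma Bisects.even_card {n : ℕ} {X : Fin n → ℤ} {A : Finset (Fin n)} (hX : IsBicoloring n X)
    (h : Bisects X A) : Even A.card := by
  have hfull : (univ.filter fun i => X i ≠ 0) = univ :=
    (card_eq_iff_eq_univ _).1 (by rw [hX.2, Fintype.card_fin])
  have hnot : (A.filter fun i => ¬X i = 1) = A.filter fun i => X i = -1 := by
    refine filter_congr fun i _ => ?_
    have h0 : X i ≠ 0 := (mem_filter.1 (hfull.ge (mem_univ i))).2
    rcases hX.1 i with hi | hi | hi <;> simp_all
  have hsplit := card_filter_add_card_filter_not (s := A) (fun i => X i = 1)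
  rw [hnot, ← h.1] at hsplit
  exact ⟨_, hsplit.symm⟩

lemma betaG_le_of_family {n d N : ℕ} {E : Finset (Finset (Fin n))} {𝒳 : Finset (Fin n → ℤ)}
    (hc : 𝒳.card ≤ N) (h : IsIBF d E 𝒳) : betaG d E ≤ N :=
  le_trans (Nat.sInf_le (show 𝒳.card ∈ _ from ⟨𝒳, rfl, h⟩)) hc

lemma betaG_self_le {n : ℕ} (E : Finset (Finset (Fin n))) : betaG n E ≤ n + 1 := by
  by_cases hE : ∃ 𝒳, IsIBF n E 𝒳
  · obtain ⟨𝒴, hb, hY⟩ := hE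
    obtain ⟨𝒳, hc, hX, hX'⟩ := exists_threshold_family n
    refine betaG_le_of_family hc ⟨hX, fun A hA h2 hu => ?_⟩
    obtain ⟨Y, hYm, hYA⟩ := hY A hA h2 hu
    exact hX' A (hYA.even_card (hb Y hYm)) (card_pos.1 (by omega))
  · have : {t | ∃ 𝒳 : Finset (Fin n → ℤ), 𝒳.card = t ∧ IsIBF n E 𝒳} = ∅ := by
      ext t
      simp only [Set.mem_ofPred_eq, Set.mem_empty_iff_false, iff_false]
      exact fun ⟨𝒳, _, h⟩ => hE ⟨𝒳, h⟩
    rw [betaG, this, Nat.sInf_empty]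
    exact Nat.zero_le _

lemma IsBisectable.betaG_le {n d q N : ℕ} {R₀ : Finset (Fin n)} (h : IsBisectable d R₀ univ q N)
    {E : Finset (Finset (Fin n))} (hE : ∀ A ∈ E, q ≤ A.card) : betaG d E ≤ N := by
  obtain ⟨𝒳, hc, hb, hX⟩ := h
  refine betaG_le_of_family hc ⟨hb, fun A hA _ hu => hX A (fun ho h => ?_) (Or.inl ?_)⟩
  · exact hu ho (univ_subset_iff.1 h)
  · rw [inter_univ]
    exact hE A hA

lemma betaG_le_of_lt {n d m : ℕ} (hd : 2 ≤ d) (hdn : d + 1 ≤ n) {E : Finset (Finset (Fin n))}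
    (hm : m * (d - 1) < n - 1) (hm' : n - 1 ≤ (m + 1) * (d - 1))
    (hE : ∀ A ∈ E, n - 1 < (d - 1) * A.card) : betaG d E ≤ (m + 1) * (d + 1) := by
  obtain ⟨m, rfl⟩ : ∃ k, m = k + 1 := by
    refine Nat.exists_eq_succ_of_ne_zero ?_
    rintro rfl
    omega
  rcases hm'.eq_or_lt with heq | hlt
  · obtain ⟨R, hR, hRb⟩ := exists_isBisectable_of_lt hdn
    have := IsBisectable.extend_univ hR hd (m + 1) R 2 (d + 1) hRb subset_rfl ?_
    · refine (IsBisectable.betaG_le this fun A hA => ?_).trans (by ring_nf; rfl)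
      have h1 := hE A hA
      rw [heq, mul_comm] at h1
      have := lt_of_mul_lt_mul_left h1 (Nat.zero_le _)
      omega
    · have h1 : (m + 1 + 1) * (d - 1) = (m + 1) * (d - 1) + (d - 1) := by ring
      omega
  · have hd3 : 3 ≤ d := by
      by_contra h
      obtain rfl : d = 2 := by omega
      omega
    obtain ⟨R, -, hRc⟩ := exists_subset_card_eq (s := (univ : Finset (Fin n)))
      (n := min n (2 * d - 2)) (by simp)
    have h0 := exists_isBisectable_of_le (R := R) hd3 (by omega) (by omega)
    have := IsBisectable.extend_univ (by omega) hd m R 2 _ h0 subset_rfl ?_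
    · refine (IsBisectable.betaG_le this fun A hA => ?_).trans (by ring_nf; rfl)
      have h1 := hm.trans (hE A hA)
      rw [mul_comm] at h1
      have := lt_of_mul_lt_mul_left h1 (Nat.zero_le _)
      omega
    · have h1 : (m + 1 + 1) * (d - 1) = m * (d - 1) + (2 * d - 2) := by
        rw [add_assoc, add_mul]; omega
      omega

/-- For a hypergraph `G` on `[n]` with minimum hyperedge size `k(G)`, if
`(d-1)·k(G) > n-1` then `β^d(G) ≤ ⌈(n-1)/(d-1)⌉·(d+1)`. -/
theorem betaG_upper_bound (n d : ℕ) (hd : 2 ≤ d) (hdn : d ≤ n)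
    (E : Finset (Finset (Fin n))) (hE : E.Nonempty)
    (hk : n - 1 < (d - 1) * E.inf' hE Finset.card) :
    betaG d E ≤ ⌈((n : ℚ) - 1) / ((d : ℚ) - 1)⌉₊ * (d + 1) := by
  have hd0 : (0 : ℚ) < (d : ℚ) - 1 := by
    have : (2 : ℚ) ≤ d := by exact_mod_cast hd
    linarith
  have hceil : ∀ m : ℕ, m * (d - 1) < n - 1 → m + 1 ≤ ⌈((n : ℚ) - 1) / ((d : ℚ) - 1)⌉₊ := by
    intro m hm
    refine Nat.succ_le_of_lt (Nat.lt_ceil.2 ((lt_div_iff₀ hd0).2 ?_))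
    have h : ((m * (d - 1) : ℕ) : ℚ) < ((n - 1 : ℕ) : ℚ) := by exact_mod_cast hm
    rw [Nat.cast_mul, Nat.cast_sub (by omega), Nat.cast_sub (by omega), Nat.cast_one] at h
    exact h
  rcases hdn.eq_or_lt with rfl | hlt
  · exact (betaG_self_le E).trans (Nat.le_mul_of_pos_left _ (hceil 0 (by omega)))
  · have hpos : 0 < d - 1 := by omega
    have h1 := Nat.div_mul_le_self (n - 2) (d - 1)
    have h2 := Nat.lt_div_mul_add (a := n - 2) hpos
    have hm : (n - 2) / (d - 1) * (d - 1) < n - 1 := by omega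
    refine (betaG_le_of_lt hd hlt hm (by rw [add_mul, one_mul]; omega) fun A hA => ?_).trans
      (Nat.mul_le_mul_right _ (hceil _ hm))
    exact hk.trans_le (Nat.mul_le_mul_left _ (inf'_le _ hA))
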